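/- For every k ≥ 22 with k ≡ 22 (mod 24), there exists an almost resolvable k-cycle system of order 2k+1. -/

import Mathlib

/-- The set of edges of the closed walk `c 0, c 1, …, c (k-1), c 0`.
When `c` is injective, this is a cycle of length `k`. -/
def cycleEdgeSet {V : Type*} {k : ℕ} (c : ZMod k → V) : Set (Sym2 V) :=
  {e | ∃ i : ZMod k, e = s(c i, c (i + 1))}

/-- `HasARCS k v` asserts the existence of an almost resolvable `k`-cycle system of
order `v`: a collection of `k`-cycles whose edge sets partition the edge set of the
complete graph on `v` vertices, partitioned into `(v-1)/2` almost parallel classes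
(each consisting of `(v-1)/k` pairwise vertex-disjoint `k`-cycles) together with one
half-parallel class (consisting of `(v-1)/(2k)` pairwise vertex-disjoint `k`-cycles). -/
def HasARCS (k v : ℕ) : Prop :=
  ∃ (apc : Fin ((v - 1) / 2) → Fin ((v - 1) / k) → ZMod k → Fin v)
    (hpc : Fin ((v - 1) / (2 * k)) → ZMod k → Fin v),
    (∀ i j, Function.Injective (apc i j)) ∧
    (∀ j, Function.Injective (hpc j)) ∧
    (∀ i, ∀ j₁ j₂, j₁ ≠ j₂ →
      Disjoint (Set.range (apc i j₁)) (Set.range (apc i j₂))) ∧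
    (∀ j₁ j₂, j₁ ≠ j₂ → Disjoint (Set.range (hpc j₁)) (Set.range (hpc j₂))) ∧
    (∀ e : Sym2 (Fin v), ¬ e.IsDiag →
      ∃! p : (Fin ((v - 1) / 2) × Fin ((v - 1) / k)) ⊕ Fin ((v - 1) / (2 * k)),
        e ∈ Sum.elim (fun q => cycleEdgeSet (apc q.1 q.2))
              (fun j => cycleEdgeSet (hpc j)) p)

/-- A map onto a subset as large as its domain is injective. -/
theorem inj_of_cover {α β : Type*} [Fintype α] (f : α → β) (p : β → Prop)
    [Fintype {b // p b}] (h : ∀ b, p b → ∃ a, f a = b)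
    (hc : Fintype.card {b // p b} = Fintype.card α) : Function.Injective f := by
  choose g hg using h
  have hinj : Function.Injective (fun b : {b // p b} => g b.1 b.2) := by
    intro x y hxy
    apply Subtype.ext
    have h1 := hg x.1 x.2
    have h2 := hg y.1 y.2
    simp only at hxy
    rw [← h1, ← h2, hxy]
  have hbij := (Fintype.bijective_iff_injective_and_card _).2 ⟨hinj, hc⟩
  intro x y hxy
  obtain ⟨b, rfl⟩ := hbij.2 x
  obtain ⟨c, rfl⟩ := hbij.2 y
  simp only [hg b.1 b.2, hg c.1 c.2] at hxy
  simp only [hxy]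

theorem framework {V I : Type} [Fintype V] [DecidableEq V] [Fintype I] (k : ℕ) (hk : 0 < k)
    (hV : Fintype.card V = 2 * k + 1) (hI : Fintype.card I = k)
    (cy : I → Fin 2 → ZMod k → V) (hp : ZMod k → V) (miss : I → V)
    (hcov : ∀ i v, v ≠ miss i → ∃ j x, cy i j x = v) (hhp : Function.Injective hp)
    (hE : ∀ u v, u ≠ v → (∃ i j x, s(cy i j x, cy i j (x + 1)) = s(u, v)) ∨
      ∃ x, s(hp x, hp (x + 1)) = s(u, v)) : HasARCS k (2 * k + 1) := by
  have : NeZero k := ⟨hk.ne'⟩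
  have e1 : (2 * k + 1 - 1) / 2 = k := by omega
  have e2 : (2 * k + 1 - 1) / k = 2 := by
    rw [Nat.add_sub_cancel]; exact Nat.mul_div_cancel _ hk
  have e3 : (2 * k + 1 - 1) / (2 * k) = 1 := by
    rw [Nat.add_sub_cancel]; exact Nat.div_self (by omega)
  unfold HasARCS
  rw [e1, e2, e3]
  let eV : V ≃ Fin (2 * k + 1) := Fintype.equivFinOfCardEq hV
  let eI : I ≃ Fin k := Fintype.equivFinOfCardEq hI
  have hinj : ∀ i, Function.Injective (fun q : Fin 2 × ZMod k => cy i q.1 q.2) := by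
    intro i
    refine inj_of_cover _ (fun v => v ≠ miss i) ?_ ?_
    · intro v hv
      obtain ⟨j, x, h⟩ := hcov i v hv
      exact ⟨(j, x), h⟩
    · simp [Fintype.card_subtype_compl, hV, ZMod.card]
  let F : ((Fin k × Fin 2) ⊕ Fin 1) × ZMod k → Sym2 (Fin (2 * k + 1)) := fun q =>
    Sum.elim (fun r : Fin k × Fin 2 =>
      s(eV (cy (eI.symm r.1) r.2 q.2), eV (cy (eI.symm r.1) r.2 (q.2 + 1))))
      (fun _ => s(eV (hp q.2), eV (hp (q.2 + 1)))) q.1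
  have hFcov : ∀ e : Sym2 (Fin (2 * k + 1)), ¬ e.IsDiag → ∃ q, F q = e := by
    intro e
    induction e using Sym2.ind with
    | _ u v =>
      intro huv
      have huv' : eV.symm u ≠ eV.symm v := by
        intro h; exact huv (by simpa using h)
      rcases hE _ _ huv' with ⟨i, j, x, h⟩ | ⟨x, h⟩
      · refine ⟨(Sum.inl (eI i, j), x), ?_⟩
        have := congrArg (Sym2.map eV) h
        simpa [F] using this
      · refine ⟨(Sum.inr 0, x), ?_⟩
        have := congrArg (Sym2.map eV) h
        simpa [F] using this
  have hFinj : Function.Injective F := by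
    refine inj_of_cover F (fun e => ¬ e.IsDiag) hFcov ?_
    rw [Sym2.card_subtype_not_diag]
    simp only [Fintype.card_fin, Fintype.card_prod, Fintype.card_sum, ZMod.card]
    rw [Nat.choose_two_right, Nat.add_sub_cancel]
    rw [show (2 * k + 1) * (2 * k) = ((k * 2 + 1) * k) * 2 by ring]
    exact Nat.mul_div_cancel _ (by norm_num)
  refine ⟨fun i j x => eV (cy (eI.symm i) j x), fun _ x => eV (hp x), ?_, ?_, ?_, ?_, ?_⟩
  · intro i j x y hxy
    have := @hinj (eI.symm i) (j, x) (j, y) (eV.injective hxy)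
    simpa using this
  · intro j x y hxy
    exact hhp (eV.injective hxy)
  · intro i j₁ j₂ hj
    rw [Set.disjoint_left]
    rintro _ ⟨x, rfl⟩ ⟨y, hy⟩
    have := @hinj (eI.symm i) (j₂, y) (j₁, x) (eV.injective hy)
    exact hj (congrArg Prod.fst this).symm
  · intro j₁ j₂ hj
    exact absurd (Subsingleton.elim _ _) hj
  · intro e he
    have key : ∀ p : (Fin k × Fin 2) ⊕ Fin 1,
        e ∈ Sum.elim (fun q : Fin k × Fin 2 =>
          cycleEdgeSet (fun x => eV (cy (eI.symm q.1) q.2 x)))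
              (fun _ => cycleEdgeSet (fun x => eV (hp x))) p ↔ ∃ x, F (p, x) = e := by
      rintro (p | p)
      · simp only [Sum.elim_inl, cycleEdgeSet, Set.mem_ofPred_eq, F]
        exact exists_congr fun _ => eq_comm
      · simp only [Sum.elim_inr, cycleEdgeSet, Set.mem_ofPred_eq, F]
        exact exists_congr fun _ => eq_comm
    obtain ⟨⟨p, x⟩, hq⟩ := hFcov e he
    refine ⟨p, (key p).2 ⟨x, hq⟩, ?_⟩
    intro p' hp'
    obtain ⟨y, hy⟩ := (key p').1 hp'
    have := hFinj (hy.trans hq.symm)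
    exact congrArg Prod.fst this

/-- The closed walk given by a list of length `k`. -/
def cyc {α : Type} (k : ℕ) (L : List (Option α)) : ZMod k → Option α := fun i => L.getD i.val none

theorem chain_cyc {α : Type} (k : ℕ) (hk : 1 < k) (L : List (Option α)) (hL : L.length = k)
    (R : Option α → Option α → Prop) (h : ∀ x : ZMod k, R (cyc k L x) (cyc k L (x + 1))) :
    List.IsChain R (L ++ L.take 1) := by
  have : NeZero k := ⟨by omega⟩
  have : Fact (1 < k) := ⟨hk⟩
  rw [List.isChain_iff_getElem]
  intro i hi
  have hi' : i < k := by
    simp [hL] at hi; omega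
  have hx := h (i : ZMod k)
  have v1 : ((i : ZMod k)).val = i := ZMod.val_cast_of_lt hi'
  have v2 : ((i : ZMod k) + 1).val = (i + 1) % k := by
    rw [ZMod.val_add, v1, ZMod.val_one]
  simp only [cyc, v1, v2] at hx
  rw [List.getElem_append_left (by omega)]
  rw [List.getD_eq_getElem _ _ (by omega)] at hx
  rcases Nat.lt_or_ge (i + 1) k with h1 | h1
  · rw [List.getElem_append_left (by omega)]
    rw [List.getD_eq_getElem _ _ (by rw [Nat.mod_eq_of_lt h1]; omega)] at hx
    simpa [Nat.mod_eq_of_lt h1] using hx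
  · have : i + 1 = k := by omega
    rw [List.getElem_append_right (by omega)]
    rw [List.getD_eq_getElem _ _ (by rw [this, Nat.mod_self]; omega)] at hx
    simpa [this, hL] using hx

/-- The point `x` of the orbit `i`. -/
def pt {t : ℕ} (i : Fin 4) (x : ZMod (4 * t + 3)) : Option (Fin 4 × ZMod (4 * t + 3)) := some (i, x)

/-- Translation by `y`, fixing the point at infinity. -/
def sh {t : ℕ} (y : ZMod (4 * t + 3)) :
    Option (Fin 4 × ZMod (4 * t + 3)) → Option (Fin 4 × ZMod (4 * t + 3)) :=
  Option.map (fun p => (p.1, p.2 + y))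

/-- Zigzag path `a_i, b_j, (a+e)_i, (b-e)_j, …` with `2 * l` vertices. -/
def zz {t : ℕ} (i : Fin 4) (a : ZMod (4 * t + 3)) (j : Fin 4) (b e : ZMod (4 * t + 3)) :
    ℕ → List (Option (Fin 4 × ZMod (4 * t + 3)))
  | 0 => []
  | l + 1 => zz i a j b e l ++ [pt i (a + e * (l : ZMod (4 * t + 3))), pt j (b - e * (l : ZMod (4 * t + 3)))]

section
variable {t : ℕ} (i : Fin 4) (a : ZMod (4 * t + 3)) (j : Fin 4) (b e : ZMod (4 * t + 3))

theorem zz_length (l : ℕ) : (zz i a j b e l).length = 2 * l := by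
  induction l with
  | zero => rfl
  | succ l ih => simp [zz, ih]; ring

theorem zz_head (l : ℕ) (hl : 0 < l) : (zz i a j b e l).head? = some (pt i a) := by
  induction l with
  | zero => omega
  | succ l ih =>
    rcases Nat.eq_zero_or_pos l with rfl | h
    · simp [zz]
    · simp [zz, ih h]

theorem zz_last (l : ℕ) (hl : 0 < l) :
    (zz i a j b e l).getLast? = some (pt j (b - e * ((l : ZMod (4 * t + 3)) - 1))) := by
  cases l with
  | zero => omega
  | succ l => simp [zz]

theorem zz_mem (l : ℕ) (s : ℕ) (hs : s < l) :
    pt i (a + e * (s : ZMod (4 * t + 3))) ∈ zz i a j b e l ∧ pt j (b - e * (s : ZMod (4 * t + 3))) ∈ zz i a j b e l := by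
  induction l with
  | zero => omega
  | succ l ih =>
    rcases Nat.lt_succ_iff_lt_or_eq.1 hs with h | rfl
    · simp [zz, ih h]
    · simp [zz]

theorem zz_mem_left (l : ℕ) (x : ZMod (4 * t + 3)) (s : ℕ) (hs : s < l) (hx : x = a + e * s) :
    pt i x ∈ zz i a j b e l := hx ▸ (zz_mem i a j b e l s hs).1

theorem zz_mem_right (l : ℕ) (x : ZMod (4 * t + 3)) (s : ℕ) (hs : s < l) (hx : x = b - e * s) :
    pt j x ∈ zz i a j b e l := hx ▸ (zz_mem i a j b e l s hs).2

theorem zz_chain (Q : Option (Fin 4 × ZMod (4 * t + 3)) → Option (Fin 4 × ZMod (4 * t + 3)) → Prop)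
    (l : ℕ) (h : List.IsChain Q (zz i a j b e l)) :
    (∀ s : ℕ, s < l → Q (pt i (a + e * s)) (pt j (b - e * s))) ∧
    (∀ s : ℕ, s + 1 < l → Q (pt j (b - e * s)) (pt i (a + e * (s + 1)))) := by
  induction l with
  | zero => exact ⟨fun s hs => by omega, fun s hs => by omega⟩
  | succ l ih =>
    simp only [zz, List.isChain_append] at h
    obtain ⟨h1, h2, h3⟩ := h
    obtain ⟨ih1, ih2⟩ := ih h1
    constructor
    · intro s hs
      rcases Nat.lt_succ_iff_lt_or_eq.1 hs with h | rfl
      · exact ih1 s h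
      · simpa using h2
    · intro s hs
      rcases Nat.lt_succ_iff_lt_or_eq.1 hs with h | rfl
      · exact ih2 s h
      · rw [zz_last _ _ _ _ _ _ (by omega)] at h3
        simpa using h3

end

/-- First cycle of the base class `A`. -/
def cA1 (t : ℕ) : List (Option (Fin 4 × ZMod (4 * t + 3))) :=
  [pt 0 (t + 1), pt 2 (4 * t + 2), pt 2 0] ++ (zz 0 t 0 (t + 2) (-1) t ++
    (zz 2 t 2 (t + 2) (-1) t ++ ([pt 3 (4 * t + 2)] ++
    (zz 2 (2 * t + 2) 3 (4 * t + 1) 1 (2 * t) ++ [pt 3 0, none]))))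

/-- Second cycle of the base class `A`. -/
def cA2 (t : ℕ) : List (Option (Fin 4 × ZMod (4 * t + 3))) :=
  [pt 0 (2 * t + 2), pt 1 0, pt 3 (t + 1)] ++ (zz 3 t 3 (t + 2) (-1) t ++
    ([pt 1 (t + 1)] ++ (zz 1 t 1 (t + 2) (-1) t ++ ([pt 2 (t + 1), pt 1 (2 * t + 2)] ++
    zz 0 (4 * t + 2) 1 (2 * t + 3) (-1) (2 * t)))))

/-- First cycle of the base class `B`. -/
def cB1 (t : ℕ) : List (Option (Fin 4 × ZMod (4 * t + 3))) :=
  [pt 0 (2 * t), pt 0 (4 * t + 2)] ++ (zz 0 0 3 (t - 2) 1 (2 * t) ++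
    ([pt 2 (t - 1), pt 1 (2 * t + 1), pt 1 (4 * t + 2), pt 3 (t + 1)] ++
    zz 1 (4 * t + 1) 3 (t + 2) (-1) (2 * t)))

/-- Second cycle of the base class `B`. -/
def cB2 (t : ℕ) : List (Option (Fin 4 × ZMod (4 * t + 3))) :=
  [pt 0 (4 * t + 1), pt 3 t, pt 2 (3 * t + 1), pt 2 t, none, pt 1 (2 * t)] ++
    (zz 2 (t + 1) 1 (2 * t - 1) 1 (2 * t) ++ zz 0 (2 * t + 1) 2 (t - 2) 1 (2 * t))

theorem cA1_length (t : ℕ) : (cA1 t).length = 2 * (4 * t + 3) := by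
  simp [cA1, zz_length]; ring
theorem cA2_length (t : ℕ) : (cA2 t).length = 2 * (4 * t + 3) := by
  simp [cA2, zz_length]; ring
theorem cB1_length (t : ℕ) : (cB1 t).length = 2 * (4 * t + 3) := by
  simp [cB1, zz_length]; ring
theorem cB2_length (t : ℕ) : (cB2 t).length = 2 * (4 * t + 3) := by
  simp [cB2, zz_length]; ring

section
variable {t : ℕ}
  (Q : Option (Fin 4 × ZMod (4 * t + 3)) → Option (Fin 4 × ZMod (4 * t + 3)) → Prop)

/-- All edges from orbit `i` to orbit `j` of difference `d` satisfy `Q`. -/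
def Cov (i j : Fin 4) (d : ZMod (4 * t + 3)) : Prop := ∀ x, Q (pt i x) (pt j (x + d))

theorem n_eq_zero (t : ℕ) : (4 * t + 3 : ZMod (4 * t + 3)) = 0 := by
  have := ZMod.natCast_self (4 * t + 3)
  push_cast at this
  exact this

theorem exists_rep {t : ℕ} (d : ZMod (4 * t + 3)) : ∃ r : ℕ, r < 4 * t + 3 ∧ d = r :=
  ⟨d.val, ZMod.val_lt d, (ZMod.natCast_zmod_val d).symm⟩

theorem cov_of_edge (hsh : ∀ y u v, Q u v → Q (sh y u) (sh y v))
    {i j : Fin 4} {z z' : ZMod (4 * t + 3)} (h : Q (pt i z) (pt j z'))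
    {d : ZMod (4 * t + 3)} (hd : d = z' - z) : Cov Q i j d := by
  intro x
  have := hsh (x - z) _ _ h
  simp only [sh, pt, Option.map_some] at this ⊢
  convert this using 3
  · ring_nf
  · rw [hd]; ring_nf

theorem cov_of_edge' (hsymm : ∀ u v, Q u v → Q v u)
    (hsh : ∀ y u v, Q u v → Q (sh y u) (sh y v))
    {i j : Fin 4} {z z' : ZMod (4 * t + 3)} (h : Q (pt j z') (pt i z))
    {d : ZMod (4 * t + 3)} (hd : d = z' - z) : Cov Q i j d :=
  cov_of_edge Q hsh (hsymm _ _ h) hd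

theorem cov_symm (hsymm : ∀ u v, Q u v → Q v u)
    (hsh : ∀ y u v, Q u v → Q (sh y u) (sh y v))
    {i j : Fin 4} {d : ZMod (4 * t + 3)} (h : Cov Q i j d) : Cov Q j i (-d) :=
  cov_of_edge' Q hsymm hsh (h 0) (by ring)

theorem cov_zz (hsymm : ∀ u v, Q u v → Q v u)
    (hsh : ∀ y u v, Q u v → Q (sh y u) (sh y v))
    (i : Fin 4) (a : ZMod (4 * t + 3)) (j : Fin 4) (b e : ZMod (4 * t + 3)) (l : ℕ)
    (h : List.IsChain Q (zz i a j b e l)) (r : ℕ) (hr : r + 1 < 2 * l)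
    {d : ZMod (4 * t + 3)} (hd : d = b - a - e * r) : Cov Q i j d := by
  obtain ⟨h1, h2⟩ := zz_chain i a j b e Q l h
  rcases Nat.even_or_odd' r with ⟨s, rfl | rfl⟩
  · exact cov_of_edge Q hsh (h1 s (by omega)) (by rw [hd]; push_cast; ring)
  · exact cov_of_edge' Q hsymm hsh (h2 s (by omega)) (by rw [hd]; push_cast; ring)

theorem cov_pure (hsymm : ∀ u v, Q u v → Q v u)
    (hsh : ∀ y u v, Q u v → Q (sh y u) (sh y v))
    (i : Fin 4) (h : List.IsChain Q (zz i (t : ZMod (4 * t + 3)) i (t + 2) (-1) t))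
    (h1 : Cov Q i i 1) (h2 : Cov Q i i (2 * t + 1)) (d : ZMod (4 * t + 3)) (hd : d ≠ 0) :
    Cov Q i i d := by
  have hn := n_eq_zero t
  have key : ∀ r : ℕ, 0 < r → r ≤ 2 * t + 1 → Cov Q i i (r : ZMod (4 * t + 3)) := by
    intro r hr0 hr
    by_cases hr1 : r = 1
    · subst hr1; simpa using h1
    by_cases hr2 : r = 2 * t + 1
    · subst hr2; simpa using h2
    obtain ⟨s, rfl⟩ : ∃ s, r = s + 2 := ⟨r - 2, by omega⟩
    exact cov_zz Q hsymm hsh _ _ _ _ _ _ h s (by omega) (by push_cast; ring)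
  obtain ⟨r, hr, rfl⟩ := exists_rep d
  have hr0 : 0 < r := by
    rcases Nat.eq_zero_or_pos r with rfl | h
    · simp at hd
    · exact h
  by_cases h3 : r ≤ 2 * t + 1
  · exact key r hr0 h3
  · obtain ⟨s, hs⟩ : ∃ s, r + s = 4 * t + 3 := ⟨4 * t + 3 - r, by omega⟩
    have hs' : (r : ZMod (4 * t + 3)) + s = 4 * t + 3 := by exact_mod_cast congrArg Nat.cast hs
    have := cov_symm Q hsymm hsh (key s (by omega) (by omega))
    rwa [show (r : ZMod (4 * t + 3)) = - (s : ZMod (4 * t + 3)) by linear_combination hs' + hn]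

theorem cov_mixed (hsymm : ∀ u v, Q u v → Q v u)
    (hsh : ∀ y u v, Q u v → Q (sh y u) (sh y v))
    (i j : Fin 4) (a b e : ZMod (4 * t + 3)) (he : e * e = 1)
    (h : List.IsChain Q (zz i a j b e (2 * t)))
    (h1 : Cov Q i j (b - a + e)) (h2 : Cov Q i j (b - a + 2 * e))
    (h3 : Cov Q i j (b - a + 3 * e)) (h4 : Cov Q i j (b - a + 4 * e)) (d : ZMod (4 * t + 3)) :
    Cov Q i j d := by
  have hn := n_eq_zero t
  obtain ⟨r, hr, hd⟩ := exists_rep ((b - a - d) * e)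
  have hd' : d = b - a - e * r := by linear_combination (-e) * hd + (b - a - d) * he
  by_cases c0 : r + 1 < 2 * (2 * t)
  · exact cov_zz Q hsymm hsh _ _ _ _ _ _ h r c0 hd'
  obtain ⟨s, hs⟩ : ∃ s, r + s = 4 * t + 3 := ⟨4 * t + 3 - r, by omega⟩
  have hs' : (r : ZMod (4 * t + 3)) + s = 4 * t + 3 := by exact_mod_cast congrArg Nat.cast hs
  have hd2 : d = b - a + s * e := by linear_combination hd' - e * hs' - e * hn
  have : s = 1 ∨ s = 2 ∨ s = 3 ∨ s = 4 := by omega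
  rcases this with rfl | rfl | rfl | rfl
  · rw [hd2]; simpa using h1
  · rw [hd2]; simpa using h2
  · rw [hd2]; simpa using h3
  · rw [hd2]; simpa using h4

theorem cov_all (hsymm : ∀ u v, Q u v → Q v u)
    (hsh : ∀ y u v, Q u v → Q (sh y u) (sh y v))
    (ht : 0 < t)
    (hA1 : List.IsChain Q (cA1 t ++ (cA1 t).take 1))
    (hA2 : List.IsChain Q (cA2 t ++ (cA2 t).take 1))
    (hB1 : List.IsChain Q (cB1 t ++ (cB1 t).take 1))
    (hB2 : List.IsChain Q (cB2 t ++ (cB2 t).take 1))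
    (hH1 : Cov Q 0 3 (t - 1)) (hH2 : Cov Q 0 3 t) (u v : Option (Fin 4 × ZMod (4 * t + 3)))
    (huv : u ≠ v) : Q u v := by
  have hn := n_eq_zero t
  have h2t : 0 < 2 * t := by omega
  simp [cA1, List.isChain_append, List.isChain_cons, zz_head, zz_last, ht, List.head?_append] at hA1
  simp [cA2, List.isChain_append, List.isChain_cons, zz_head, zz_last, ht, List.head?_append] at hA2
  simp [cB1, List.isChain_append, List.isChain_cons, zz_head, zz_last, ht, List.head?_append] at hB1
  simp [cB2, List.isChain_append, List.isChain_cons, zz_head, zz_last, ht, List.head?_append] at hB2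
  obtain ⟨a1, a2, a3, zP0, ⟨zP2, ⟨a4, zM23, ⟨a5, a6⟩, a7⟩, a8⟩, a9⟩ := hA1
  obtain ⟨b1, b2, b3, zP3, ⟨b4, zP1, ⟨b5, b6, zM01, b7⟩, b8⟩, b9⟩ := hA2
  obtain ⟨c1, c2, zM03, ⟨c3, c4, c5, c6, zM13, c7⟩, c8⟩ := hB1
  obtain ⟨d1, d2, d3, d4, d5, d6, zM21, ⟨zM02, d7⟩, d8⟩ := hB2
  have p0 : ∀ d ≠ 0, Cov Q 0 0 d := cov_pure Q hsymm hsh 0 zP0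
    (cov_of_edge Q hsh c2 (by linear_combination hn))
    (cov_of_edge' Q hsymm hsh c1 (by linear_combination hn))
  have p1 : ∀ d ≠ 0, Cov Q 1 1 d := cov_pure Q hsymm hsh 1 zP1
    (cov_of_edge' Q hsymm hsh b4 (by ring))
    (cov_of_edge Q hsh c4 (by ring))
  have p2 : ∀ d ≠ 0, Cov Q 2 2 d := cov_pure Q hsymm hsh 2 zP2
    (cov_of_edge Q hsh a2 (by linear_combination hn))
    (cov_of_edge' Q hsymm hsh d3 (by ring))
  have p3 : ∀ d ≠ 0, Cov Q 3 3 d := cov_pure Q hsymm hsh 3 zP3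
    (cov_of_edge' Q hsymm hsh b3 (by ring))
    (cov_of_edge Q hsh a7 (by linear_combination hn))
  have m01 : ∀ d, Cov Q 0 1 d := cov_mixed Q hsymm hsh 0 1 _ _ _ (by ring) zM01
    (cov_of_edge' Q hsymm hsh b6 (by ring))
    (cov_of_edge' Q hsymm hsh d8 (by ring))
    (cov_of_edge Q hsh b1 (by ring))
    (cov_of_edge' Q hsymm hsh b7 (by linear_combination -hn))
  have m23 : ∀ d, Cov Q 2 3 d := cov_mixed Q hsymm hsh 2 3 _ _ _ (by ring) zM23
    (cov_of_edge' Q hsymm hsh a4 (by ring))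
    (cov_of_edge Q hsh a8 (by ring))
    (cov_of_edge' Q hsymm hsh d2 (by linear_combination hn))
    (cov_of_edge' Q hsymm hsh c8 (by linear_combination hn))
  have m02 : ∀ d, Cov Q 0 2 d := cov_mixed Q hsymm hsh 0 2 _ _ _ (by ring) zM02
    (cov_of_edge Q hsh a1 (by linear_combination -hn))
    (cov_of_edge Q hsh a9 (by ring))
    (cov_of_edge' Q hsymm hsh a3 (by ring))
    (cov_of_edge' Q hsymm hsh d7 (by linear_combination hn))
  have m03 : ∀ d, Cov Q 0 3 d := cov_mixed Q hsymm hsh 0 3 _ _ _ (by ring) zM03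
    (by convert hH1 using 1; ring)
    (by convert hH2 using 1; ring)
    (cov_of_edge' Q hsymm hsh c7 (by ring))
    (cov_of_edge Q hsh d1 (by linear_combination hn))
  have m21 : ∀ d, Cov Q 2 1 d := cov_mixed Q hsymm hsh 2 1 _ _ _ (by ring) zM21
    (cov_of_edge' Q hsymm hsh d6 (by ring))
    (cov_of_edge' Q hsymm hsh b8 (by ring))
    (cov_of_edge Q hsh b5 (by ring))
    (cov_of_edge Q hsh c3 (by ring))
  have m13 : ∀ d, Cov Q 1 3 d := cov_mixed Q hsymm hsh 1 3 _ _ _ (by ring) zM13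
    (cov_of_edge' Q hsymm hsh c6 (by ring))
    (cov_of_edge Q hsh c5 (by ring))
    (cov_of_edge Q hsh b2 (by linear_combination -hn))
    (cov_of_edge' Q hsymm hsh b9 (by linear_combination -hn))
  have rev : ∀ i j : Fin 4, (∀ d, Cov Q i j d) → ∀ d, Cov Q j i d := by
    intro i j h d
    have := cov_symm Q hsymm hsh (h (-d))
    rwa [neg_neg] at this
  have hinf : ∀ i : Fin 4, ∃ z, Q none (pt i z) := by
    intro i
    fin_cases i
    · exact ⟨_, a6⟩
    · exact ⟨_, d5⟩
    · exact ⟨_, hsymm _ _ d4⟩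
    · exact ⟨_, hsymm _ _ a5⟩
  have hinf' : ∀ (i : Fin 4) x, Q none (pt i x) := by
    intro i x
    obtain ⟨z, hz⟩ := hinf i
    have := hsh (x - z) _ _ hz
    simpa [sh, pt] using this
  have hmix : ∀ i j : Fin 4, i ≠ j → ∀ d, Cov Q i j d := by
    intro i j hij
    fin_cases i <;> fin_cases j <;> first
      | exact absurd rfl hij
      | assumption
      | exact rev _ _ (by assumption)
  have hpure : ∀ i : Fin 4, ∀ d ≠ 0, Cov Q i i d := by
    intro i
    fin_cases i <;> assumption
  match u, v, huv with
  | none, none, h => exact absurd rfl h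
  | none, some (i, x), _ => exact hinf' i x
  | some (i, x), none, _ => exact hsymm _ _ (hinf' i x)
  | some (i, x), some (j, y), h =>
    have : Cov Q i j (y - x) := by
      by_cases hij : i = j
      · subst hij
        refine hpure i _ fun h0 => h ?_
        rw [sub_eq_zero.1 h0]
      · exact hmix i j hij _
    have := this x
    rwa [add_sub_cancel] at this

end

section
variable {t : ℕ}

theorem cover_A (v : Option (Fin 4 × ZMod (4 * t + 3))) (hv : v ≠ pt 0 0) :
    v ∈ cA1 t ∨ v ∈ cA2 t := by
  have hn := n_eq_zero t
  rcases v with _ | ⟨i, x⟩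
  · left; simp [cA1]
  change pt i x ≠ _ at hv
  change pt i x ∈ _ ∨ pt i x ∈ _
  obtain ⟨r, hr, rfl⟩ := exists_rep x
  -- the pure zigzag of orbit `i`
  have hP : r ≠ 0 → r ≠ t + 1 → r < 2 * t + 2 →
      pt i (r : ZMod (4 * t + 3)) ∈ zz i (t : ZMod (4 * t + 3)) i (t + 2) (-1) t := by
    intro h0 h1 h2
    rcases Nat.lt_or_ge r (t + 1) with h | h
    · obtain ⟨s, rfl⟩ : ∃ s, t = r + s := ⟨t - r, by omega⟩
      exact zz_mem_left _ _ _ _ _ _ _ s (by omega) (by push_cast; ring)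
    · obtain ⟨s, rfl⟩ : ∃ s, r = t + 2 + s := ⟨r - (t + 2), by omega⟩
      exact zz_mem_right _ _ _ _ _ _ _ s (by omega) (by push_cast; ring)
  have c0 : r = 0 → (r : ZMod (4 * t + 3)) = 0 := by rintro rfl; simp
  have c1 : r = t + 1 → (r : ZMod (4 * t + 3)) = t + 1 := by rintro rfl; simp
  have c2 : r = 2 * t + 2 → (r : ZMod (4 * t + 3)) = 2 * t + 2 := by rintro rfl; simp
  have c4 : r = 4 * t + 2 → (r : ZMod (4 * t + 3)) = 4 * t + 2 := by rintro rfl; simp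
  have zdown : 2 * t + 2 < r → ∃ s : ℕ, s < 2 * t ∧
      (r : ZMod (4 * t + 3)) = 4 * t + 2 - s := by
    intro h
    obtain ⟨s, hs⟩ : ∃ s, 4 * t + 2 = r + s := ⟨4 * t + 2 - r, by omega⟩
    have hs' : (4 * t + 2 : ZMod (4 * t + 3)) = r + s := by exact_mod_cast congrArg Nat.cast hs
    exact ⟨s, by omega, by linear_combination -hs'⟩
  have zup : 2 * t + 2 < r → ∃ s : ℕ, s < 2 * t ∧
      (r : ZMod (4 * t + 3)) = 2 * t + 3 + s := by
    intro h
    obtain ⟨s, rfl⟩ : ∃ s, r = 2 * t + 3 + s := ⟨r - (2 * t + 3), by omega⟩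
    exact ⟨s, by omega, by push_cast; ring⟩
  have zdown' : 2 * t + 2 ≤ r → r < 4 * t + 2 → ∃ s : ℕ, s < 2 * t ∧
      (r : ZMod (4 * t + 3)) = 4 * t + 1 - s := by
    intro h h'
    obtain ⟨s, hs⟩ : ∃ s, 4 * t + 1 = r + s := ⟨4 * t + 1 - r, by omega⟩
    have hs' : (4 * t + 1 : ZMod (4 * t + 3)) = r + s := by exact_mod_cast congrArg Nat.cast hs
    exact ⟨s, by omega, by linear_combination -hs'⟩
  have zup' : 2 * t + 2 ≤ r → r < 4 * t + 2 → ∃ s : ℕ, s < 2 * t ∧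
      (r : ZMod (4 * t + 3)) = 2 * t + 2 + s := by
    intro h h'
    obtain ⟨s, rfl⟩ : ∃ s, r = 2 * t + 2 + s := ⟨r - (2 * t + 2), by omega⟩
    exact ⟨s, by omega, by push_cast; ring⟩
  fin_cases i
  · -- orbit 0
    simp only [Fin.zero_eta] at *
    by_cases h0 : r = 0
    · exact absurd (by rw [c0 h0]) hv
    by_cases h1 : r = t + 1
    · left; rw [c1 h1]; simp [cA1]
    by_cases h2 : r < 2 * t + 2
    · left; simp [cA1, hP h0 h1 h2]
    by_cases h3 : r = 2 * t + 2
    · right; rw [c2 h3]; simp [cA2]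
    obtain ⟨s, hs, hx⟩ := zdown (by omega)
    right
    simp [cA2, zz_mem_left 0 (4 * t + 2) 1 (2 * t + 3) (-1) (2 * t) _ s hs
      (hx.trans (by ring))]
  · -- orbit 1
    simp only [Fin.mk_one] at *
    right
    by_cases h0 : r = 0
    · rw [c0 h0]; simp [cA2]
    by_cases h1 : r = t + 1
    · rw [c1 h1]; simp [cA2]
    by_cases h2 : r < 2 * t + 2
    · simp [cA2, hP h0 h1 h2]
    by_cases h3 : r = 2 * t + 2
    · rw [c2 h3]; simp [cA2]
    obtain ⟨s, hs, hx⟩ := zup (by omega)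
    simp [cA2, zz_mem_right 0 (4 * t + 2) 1 (2 * t + 3) (-1) (2 * t) _ s hs
      (hx.trans (by ring))]
  · -- orbit 2
    simp only [Fin.reduceFinMk] at *
    by_cases h0 : r = 0
    · left; rw [c0 h0]; simp [cA1]
    by_cases h1 : r = t + 1
    · right; rw [c1 h1]; simp [cA2]
    left
    by_cases h2 : r < 2 * t + 2
    · simp [cA1, hP h0 h1 h2]
    by_cases h3 : r = 4 * t + 2
    · rw [c4 h3]; simp [cA1]
    obtain ⟨s, hs, hx⟩ := zup' (by omega) (by omega)
    simp [cA1, zz_mem_left 2 (2 * t + 2) 3 (4 * t + 1) 1 (2 * t) _ s hs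
      (hx.trans (by ring))]
  · -- orbit 3
    simp only [Fin.reduceFinMk] at *
    by_cases h0 : r = 0
    · left; rw [c0 h0]; simp [cA1]
    by_cases h1 : r = t + 1
    · right; rw [c1 h1]; simp [cA2]
    by_cases h2 : r < 2 * t + 2
    · right; simp [cA2, hP h0 h1 h2]
    left
    by_cases h3 : r = 4 * t + 2
    · rw [c4 h3]; simp [cA1]
    obtain ⟨s, hs, hx⟩ := zdown' (by omega) (by omega)
    simp [cA1, zz_mem_right 2 (2 * t + 2) 3 (4 * t + 1) 1 (2 * t) _ s hs
      (hx.trans (by ring))]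

theorem cover_B (v : Option (Fin 4 × ZMod (4 * t + 3))) (hv : v ≠ pt 3 (t - 1)) :
    v ∈ cB1 t ∨ v ∈ cB2 t := by
  have hn := n_eq_zero t
  rcases v with _ | ⟨i, x⟩
  · right; simp [cB2]
  change pt i x ≠ _ at hv
  change pt i x ∈ _ ∨ pt i x ∈ _
  fin_cases i
  · -- orbit 0
    simp only [Fin.zero_eta] at *
    obtain ⟨r, hr, rfl⟩ := exists_rep x
    by_cases h0 : r < 2 * t
    · left
      simp [cB1, zz_mem_left 0 0 3 (t - 2) 1 (2 * t) (r : ZMod (4 * t + 3)) r h0 (by ring)]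
    by_cases h1 : r = 2 * t
    · left; subst h1; simp [cB1]
    by_cases h2 : r = 4 * t + 1
    · right; subst h2; simp [cB2]
    by_cases h3 : r = 4 * t + 2
    · left; subst h3; simp [cB1]
    obtain ⟨s, rfl⟩ : ∃ s, r = 2 * t + 1 + s := ⟨r - (2 * t + 1), by omega⟩
    right
    have := zz_mem_left 0 (2 * t + 1) 2 (t - 2) 1 (2 * t)
      ((2 * t + 1 + s : ℕ) : ZMod (4 * t + 3)) s (by omega) (by push_cast; ring)
    simp only [cB2, List.mem_append, this, or_true]
  · -- orbit 1
    simp only [Fin.mk_one] at *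
    obtain ⟨r, hr, rfl⟩ := exists_rep x
    by_cases h0 : r < 2 * t
    · obtain ⟨s, hs⟩ : ∃ s, 2 * t = r + s + 1 := ⟨2 * t - r - 1, by omega⟩
      have hs' : (2 * t : ZMod (4 * t + 3)) = r + s + 1 := by exact_mod_cast congrArg Nat.cast hs
      right
      simp [cB2, zz_mem_right 2 (t + 1) 1 (2 * t - 1) 1 (2 * t) (r : ZMod (4 * t + 3)) s
        (by omega) (by linear_combination -hs')]
    by_cases h1 : r = 2 * t
    · right; subst h1; simp [cB2]
    left
    by_cases h2 : r = 2 * t + 1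
    · subst h2; simp [cB1]
    by_cases h3 : r = 4 * t + 2
    · subst h3; simp [cB1]
    obtain ⟨s, hs⟩ : ∃ s, 4 * t + 1 = r + s := ⟨4 * t + 1 - r, by omega⟩
    have hs' : (4 * t + 1 : ZMod (4 * t + 3)) = r + s := by exact_mod_cast congrArg Nat.cast hs
    simp [cB1, zz_mem_left 1 (4 * t + 1) 3 (t + 2) (-1) (2 * t) (r : ZMod (4 * t + 3)) s
        (by omega) (by linear_combination -hs')]
  · -- orbit 2
    simp only [Fin.reduceFinMk] at *
    obtain ⟨r, hr, hx⟩ := exists_rep (x - (t : ZMod (4 * t + 3)))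
    by_cases h0 : r = 0
    · right; subst h0
      rw [show x = t by linear_combination hx + Nat.cast_zero (R := ZMod (4 * t + 3))]
      simp [cB2]
    by_cases h1 : r = 2 * t + 1
    · right; subst h1; push_cast at hx
      rw [show x = 3 * t + 1 by linear_combination hx]
      simp [cB2]
    by_cases h2 : r = 4 * t + 2
    · left; subst h2; push_cast at hx
      rw [show x = t - 1 by linear_combination hx + hn]
      simp [cB1]
    right
    by_cases h3 : r < 2 * t + 1
    · obtain ⟨s, rfl⟩ : ∃ s, r = s + 1 := ⟨r - 1, by omega⟩
      push_cast at hx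
      simp [cB2, zz_mem_left 2 (t + 1) 1 (2 * t - 1) 1 (2 * t) x s
        (by omega) (by linear_combination hx)]
    · obtain ⟨s, hs⟩ : ∃ s, 4 * t + 1 = r + s := ⟨4 * t + 1 - r, by omega⟩
      have hs' : (4 * t + 1 : ZMod (4 * t + 3)) = r + s := by exact_mod_cast congrArg Nat.cast hs
      simp [cB2, zz_mem_right 0 (2 * t + 1) 2 (t - 2) 1 (2 * t) x s
        (by omega) (by linear_combination hx - hs' + hn)]
  · -- orbit 3
    simp only [Fin.reduceFinMk] at *
    obtain ⟨r, hr, hx⟩ := exists_rep (x - (t : ZMod (4 * t + 3)))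
    by_cases h0 : r = 0
    · right; subst h0
      rw [show x = t by linear_combination hx + Nat.cast_zero (R := ZMod (4 * t + 3))]
      simp [cB2]
    left
    by_cases h1 : r = 1
    · subst h1; push_cast at hx
      rw [show x = t + 1 by linear_combination hx]
      simp [cB1]
    by_cases h2 : r = 4 * t + 2
    · subst h2; push_cast at hx
      exact absurd (by rw [show x = t - 1 by linear_combination hx + hn]) hv
    by_cases h3 : r < 2 * t + 2
    · obtain ⟨s, rfl⟩ : ∃ s, r = s + 2 := ⟨r - 2, by omega⟩
      push_cast at hx
      simp [cB1, zz_mem_right 1 (4 * t + 1) 3 (t + 2) (-1) (2 * t) x s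
        (by omega) (by linear_combination hx)]
    · obtain ⟨s, hs⟩ : ∃ s, 4 * t + 1 = r + s := ⟨4 * t + 1 - r, by omega⟩
      have hs' : (4 * t + 1 : ZMod (4 * t + 3)) = r + s := by exact_mod_cast congrArg Nat.cast hs
      simp [cB1, zz_mem_right 0 0 3 (t - 2) 1 (2 * t) x s
        (by omega) (by linear_combination hx - hs' + hn)]

end

/-- The four base cycles. -/
def base (t : ℕ) : Fin 2 → Fin 2 → List (Option (Fin 4 × ZMod (4 * t + 3)))
  | 0, 0 => cA1 t
  | 0, 1 => cA2 t
  | 1, 0 => cB1 t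
  | 1, 1 => cB2 t

theorem base_length (t : ℕ) (a b : Fin 2) : (base t a b).length = 2 * (4 * t + 3) := by
  fin_cases a <;> fin_cases b
  · exact cA1_length t
  · exact cA2_length t
  · exact cB1_length t
  · exact cB2_length t

/-- The cycle of the half-parallel class. -/
def hpcyc (t : ℕ) : ZMod (2 * (4 * t + 3)) → Option (Fin 4 × ZMod (4 * t + 3)) := fun x =>
  if x.val % 2 = 0 then pt 0 ((x.val / 2 : ℕ) : ZMod (4 * t + 3))
  else pt 3 ((x.val / 2 : ℕ) + t : ZMod (4 * t + 3))

theorem hpcyc_cast (t m : ℕ) : hpcyc t (m : ZMod (2 * (4 * t + 3))) =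
    if m % 2 = 0 then pt 0 ((m / 2 : ℕ) : ZMod (4 * t + 3))
    else pt 3 ((m / 2 : ℕ) + t : ZMod (4 * t + 3)) := by
  have h1 : m % (2 * (4 * t + 3)) % 2 = m % 2 := Nat.mod_mul_right_mod _ _ _
  have h2 : m % (2 * (4 * t + 3)) / 2 = m / 2 % (4 * t + 3) := Nat.mod_mul_right_div_self _ _ _
  simp only [hpcyc, ZMod.val_natCast, h1, h2, ZMod.natCast_mod]

theorem hpcyc_inj (t : ℕ) : Function.Injective (hpcyc t) := by
  intro x y h
  have hx := ZMod.val_lt x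
  have hy := ZMod.val_lt y
  have key : ((x.val / 2 : ℕ) : ZMod (4 * t + 3)) = ((y.val / 2 : ℕ) : ZMod (4 * t + 3)) →
      x.val / 2 = y.val / 2 := by
    intro h
    have := (ZMod.natCast_eq_natCast_iff' _ _ _).1 h
    rwa [Nat.mod_eq_of_lt (by omega), Nat.mod_eq_of_lt (by omega)] at this
  apply ZMod.val_injective
  unfold hpcyc at h
  split_ifs at h with h1 h2 h2
  · simp only [pt, Option.some.injEq, Prod.mk.injEq, true_and] at h
    have := key h
    omega
  · simp [pt] at h
  · simp [pt] at h
  · simp only [pt, Option.some.injEq, Prod.mk.injEq, true_and, add_left_inj] at h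
    have := key h
    omega

theorem arcs_general (t : ℕ) (ht : 0 < t) :
    HasARCS (2 * (4 * t + 3)) (2 * (2 * (4 * t + 3)) + 1) := by
  let miss : Fin 2 → Option (Fin 4 × ZMod (4 * t + 3)) := ![pt 0 0, pt 3 (t - 1)]
  have hn := n_eq_zero t
  have shsh : ∀ (a b : ZMod (4 * t + 3)) u, sh a (sh b u) = sh (b + a) u := by
    intro a b u
    rcases u with _ | ⟨i, x⟩
    · rfl
    · simp [sh, add_assoc]
  have sh0 : ∀ u : Option (Fin 4 × ZMod (4 * t + 3)), sh 0 u = u := by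
    intro u
    rcases u with _ | ⟨i, x⟩
    · rfl
    · simp [sh]
  refine framework (V := Option (Fin 4 × ZMod (4 * t + 3))) (I := Fin 2 × ZMod (4 * t + 3))
    _ (by omega) ?_ ?_
    (fun i j x => sh i.2 (cyc _ (base t i.1 j) x)) (hpcyc t) (fun i => sh i.2 (miss i.1))
    ?_ (hpcyc_inj t) ?_
  · simp [ZMod.card]; ring
  · simp [ZMod.card]
  · rintro ⟨c, y⟩ v hv
    have hw : sh (-y) v ≠ miss c := by
      intro h
      apply hv
      simp only [← h, shsh, neg_add_cancel, sh0]
    have hmem : ∃ j, sh (-y) v ∈ base t c j := by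
      fin_cases c
      · rcases cover_A _ hw with h | h
        · exact ⟨0, h⟩
        · exact ⟨1, h⟩
      · rcases cover_B _ hw with h | h
        · exact ⟨0, h⟩
        · exact ⟨1, h⟩
    obtain ⟨j, hj⟩ := hmem
    obtain ⟨m, hm, hm'⟩ := List.mem_iff_getElem.1 hj
    have hm2 := hm
    rw [base_length] at hm2
    refine ⟨j, (m : ZMod (2 * (4 * t + 3))), ?_⟩
    simp only [cyc, ZMod.val_natCast, Nat.mod_eq_of_lt hm2]
    rw [List.getD_eq_getElem _ _ hm, hm', shsh, neg_add_cancel, sh0]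
  · let R : Option (Fin 4 × ZMod (4 * t + 3)) → Option (Fin 4 × ZMod (4 * t + 3)) → Prop :=
      fun u v => (∃ (i : Fin 2 × ZMod (4 * t + 3)) (j : Fin 2) (x : ZMod (2 * (4 * t + 3))),
        s(sh i.2 (cyc _ (base t i.1 j) x), sh i.2 (cyc _ (base t i.1 j) (x + 1))) = s(u, v)) ∨
        ∃ x, s(hpcyc t x, hpcyc t (x + 1)) = s(u, v)
    have hRsymm : ∀ u v, R u v → R v u := by
      intro u v h
      simp only [R] at h ⊢
      rwa [Sym2.eq_swap]
    let Q : Option (Fin 4 × ZMod (4 * t + 3)) → Option (Fin 4 × ZMod (4 * t + 3)) → Prop :=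
      fun u v => ∀ y, R (sh y u) (sh y v)
    have hchain : ∀ c j, List.IsChain Q (base t c j ++ (base t c j).take 1) := by
      intro c j
      refine chain_cyc _ (by omega) _ (base_length t c j) Q ?_
      intro x y
      exact Or.inl ⟨(c, y), j, x, rfl⟩
    have hH2 : ∀ x : ZMod (4 * t + 3), R (pt 0 x) (pt 3 (x + t)) := by
      intro x
      obtain ⟨r, hr, rfl⟩ := exists_rep x
      refine Or.inr ⟨((2 * r : ℕ) : ZMod (2 * (4 * t + 3))), ?_⟩
      rw [← Nat.cast_succ, hpcyc_cast, hpcyc_cast, if_pos (by omega), if_neg (by omega),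
        show 2 * r / 2 = r by omega, show (2 * r).succ / 2 = r by omega]
    have hH1 : ∀ x : ZMod (4 * t + 3), R (pt 0 x) (pt 3 (x + (t - 1))) := by
      intro x
      obtain ⟨r, hr, hx⟩ := exists_rep (x - 1)
      apply hRsymm
      refine Or.inr ⟨((2 * r + 1 : ℕ) : ZMod (2 * (4 * t + 3))), ?_⟩
      rw [← Nat.cast_succ, hpcyc_cast, hpcyc_cast, if_neg (by omega), if_pos (by omega),
        show (2 * r + 1) / 2 = r by omega, show (2 * r + 1).succ / 2 = r + 1 by omega]
      push_cast
      rw [← hx]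
      ring_nf
    have shpt : ∀ (y : ZMod (4 * t + 3)) i x, sh y (pt i x) = pt i (x + y) := fun _ _ _ => rfl
    have hall := cov_all Q (fun u v h y => hRsymm _ _ (h y))
      (fun y u v h z => by rw [shsh, shsh]; exact h _) ht
      (hchain 0 0) (hchain 0 1) (hchain 1 0) (hchain 1 1)
      (by intro x y; rw [shpt, shpt, add_right_comm]; exact hH1 _)
      (by intro x y; rw [shpt, shpt, add_right_comm]; exact hH2 _)
    intro u v huv
    have := hall u v huv 0
    rw [sh0, sh0] at this
    exact this

/-- For every `k ≥ 22` with `k ≡ 22 (mod 24)`, there exists an almost resolvable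
`k`-cycle system of order `2k+1`. -/
theorem arcs_mod24_case_22 (k : ℕ) (hk : 22 ≤ k) (hk24 : k % 24 = 22) :
    HasARCS k (2 * k + 1) := by
  obtain ⟨t, rfl⟩ : ∃ t, k = 2 * (4 * t + 3) := ⟨(k - 6) / 8, by omega⟩
  exact arcs_general t (by omega)
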